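/- Let f : E(G*) → E(S10) be an S10-coloring of G* and let H' be the subgraph of H induced by f^{-1}(A1) ∩ E1, where A1 is the set of the six edges of S10 that lie in a pair of parallel edges, H is the subgraph of G* isomorphic to the Petersen graph minus a vertex, and E1 = E(H). Then H' is either a circuit of length 6 or a circuit of length 8. -/

import Mathlib

/-- A loopless multigraph: each edge has an unordered pair of distinct endpoints.
Parallel edges are allowed. -/
structure Multigraph (V : Type) (E : Type) where
  ends : E → Sym2 V
  loopless : ∀ e, ¬ (ends e).IsDiag

namespace Multigraph

variable {V E V' E' V'' E'' : Type}

/-- `G.inc v` is the set `∂_G(v)` of edges of `G` incident with the vertex `v`. -/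
def inc (G : Multigraph V E) (v : V) : Set E := {e | v ∈ G.ends e}

/-- Two edges are adjacent if they are distinct and share an endpoint. -/
def EdgeAdj (G : Multigraph V E) (e₁ e₂ : E) : Prop :=
  e₁ ≠ e₂ ∧ ∃ v, e₁ ∈ G.inc v ∧ e₂ ∈ G.inc v

/-- `f` is an `H`-coloring of `G`: a proper edge-coloring (adjacent edges of `G` receive
distinct images) such that for every vertex `v` of `G` there is a vertex `u` of `H` with
`f(∂_G(v)) = ∂_H(u)`. -/
def IsColoring (G : Multigraph V E) (H : Multigraph V' E') (f : E → E') : Prop :=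
  (∀ e₁ e₂, G.EdgeAdj e₁ e₂ → f e₁ ≠ f e₂) ∧
  (∀ v : V, ∃ u : V', f '' G.inc v = H.inc u)

end Multigraph

/-- The Sylvester graph `S₁₀`: vertex `0` is the centre `w`; vertices `1,2,3` are
`z₁,z₂,z₃`; vertices `4,5` are `x₁,y₁`; vertices `6,7` are `x₂,y₂`; vertices `8,9` are
`x₃,y₃`.  Edges `9,…,14` are the three pairs of parallel edges. -/
def S10 : Multigraph (Fin 10) (Fin 15) where
  ends := ![s(0,1), s(0,2), s(0,3), s(1,4), s(1,5), s(2,6), s(2,7), s(3,8), s(3,9),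
            s(4,5), s(4,5), s(6,7), s(6,7), s(8,9), s(8,9)]
  loopless := by decide

/-- `A₁` is the set of the six edges of `S₁₀` lying in a pair of parallel edges. -/
def A1 : Set (Fin 15) := {9, 10, 11, 12, 13, 14}

/-- The graph `G*`.  Vertices `0,…,8` induce the Petersen graph minus a vertex `v₀`
(vertices `0`, `3`, `4` are the former neighbours of `v₀`); vertex `9` is `u`;
vertices `10`, `11` are `s₁`, `s₂`; vertices `12,13,14` form the triangle `t₁t₂t₃`;
vertices `15,…,23` are the three attached copies of `S₄` (with `17`, `20`, `23`
the vertices `c` joined to `s₁`, `s₂`, `t₃` respectively).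
Edges `0,…,11` form `E₁` (the copy of the Petersen graph minus a vertex),
edges `12,…,23` form `E₂`, and edges `24,…,35` are the edges of the copies of `S₄`. -/
def Gstar : Multigraph (Fin 24) (Fin 36) where
  ends := ![s(0,1), s(1,2), s(2,3), s(0,5), s(1,6), s(2,7), s(3,8), s(4,6), s(4,7),
            s(5,7), s(5,8), s(6,8),
            s(9,10), s(9,11), s(9,12), s(12,13), s(13,14), s(12,14),
            s(10,0), s(11,3), s(13,4), s(10,17), s(11,20), s(14,23),
            s(15,16), s(15,16), s(15,17), s(16,17),
            s(18,19), s(18,19), s(18,20), s(19,20),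
            s(21,22), s(21,22), s(21,23), s(22,23)]
  loopless := by decide

/-- `E₁`: the edges of the subgraph `H` of `G*` isomorphic to the Petersen graph minus
a vertex. -/
def E1 : Set (Fin 36) := {e | e.val ≤ 11}

/-- `E₂`: the edges of `G*` belonging neither to `E₁` nor to a copy of `S₄`. -/
def E2 : Set (Fin 36) := {e | 12 ≤ e.val ∧ e.val ≤ 23}

/-- `G.Reach F a b` holds if the vertices `a` and `b` are joined by a walk all of whose
edges lie in the edge set `F`. -/
def Multigraph.Reach {V E : Type} (G : Multigraph V E) (F : Set E) (a b : V) : Prop :=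
  Relation.ReflTransGen (fun x y => ∃ e ∈ F, G.ends e = s(x, y)) a b

namespace Multigraph

variable {V E : Type}

theorem reach_of_isChain (G : Multigraph V E) (S : Finset E) {l : List V}
    (h : l.IsChain fun x y => ∃ e ∈ S, G.ends e = s(x, y)) {a b : V} (ha : a ∈ l) (hb : b ∈ l) :
    G.Reach S a b := by
  have : Std.Symm fun x y => ∃ e ∈ (S : Set E), G.ends e = s(x, y) :=
    ⟨fun x y ⟨e, he, hxy⟩ => ⟨e, he, hxy.trans Sym2.eq_swap⟩⟩
  have : Std.Symm (G.Reach S) := Relation.ReflTransGen.stdSymm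
  have : IsTrans V (G.Reach S) := ⟨fun _ _ _ => Relation.ReflTransGen.trans⟩
  have hl : l.Pairwise (G.Reach S) :=
    List.isChain_iff_pairwise.mp (h.imp fun _ _ hxy => Relation.ReflTransGen.single hxy)
  exact hl.forall_of_forall (fun _ _ => Relation.ReflTransGen.refl) ha hb

variable [DecidableEq V]

/-- The set `∂_G(v)` as a finset. -/
def incFinset [Fintype E] (G : Multigraph V E) (v : V) : Finset E := {e | v ∈ G.ends e}

@[simp]
theorem coe_incFinset [Fintype E] (G : Multigraph V E) (v : V) :
    (G.incFinset v : Set E) = G.inc v := by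
  ext e
  simp [incFinset, inc]

/-- The vertices incident with an edge of `S`. -/
def support [Fintype V] (G : Multigraph V E) (S : Finset E) : Finset V :=
  {v | ∃ e ∈ S, v ∈ G.ends e}

end Multigraph

/-- The sets `∂(u)` of `S10`, each encoded as the sum of `2 ^ e` over its elements `e`. -/
def starCodes : List ℕ :=
  [2 ^ 0 + 2 ^ 1 + 2 ^ 2, 2 ^ 0 + 2 ^ 3 + 2 ^ 4, 2 ^ 1 + 2 ^ 5 + 2 ^ 6, 2 ^ 2 + 2 ^ 7 + 2 ^ 8,
   2 ^ 3 + 2 ^ 9 + 2 ^ 10, 2 ^ 4 + 2 ^ 9 + 2 ^ 10, 2 ^ 5 + 2 ^ 11 + 2 ^ 12,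
   2 ^ 6 + 2 ^ 11 + 2 ^ 12, 2 ^ 7 + 2 ^ 13 + 2 ^ 14, 2 ^ 8 + 2 ^ 13 + 2 ^ 14]

/-- `a`, `b`, `c` are the three edges at some vertex of `S10`. -/
def IsStar (a b c : Fin 15) : Prop := 2 ^ a.val + 2 ^ b.val + 2 ^ c.val ∈ starCodes

instance (a b c : Fin 15) : Decidable (IsStar a b c) := by
  unfold IsStar
  infer_instance

theorem isStar_of_eq_incFinset {a b c : Fin 15} {u : Fin 10}
    (h : {a, b, c} = S10.incFinset u) : IsStar a b c := by
  have card : ∀ u, (S10.incFinset u).card = 3 := by decide +kernel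
  have sum : ∀ u, ∑ e ∈ S10.incFinset u, 2 ^ e.val ∈ starCodes := by decide +kernel
  specialize card u
  specialize sum u
  rw [← h] at card sum
  obtain ⟨hab, hac, hbc⟩ := Finset.card_triple_eq_three_iff.mp card
  rwa [Finset.sum_insert (by simp [hab, hac]), Finset.sum_pair hbc, ← add_assoc] at sum

/-- A map of the edges of `S10` to five colors which is proper, sends `A1` to `{3, 4}` and its
complement to `{0, 1, 2}`. -/
def edgeClass : Fin 15 → Fin 5 := ![0, 1, 2, 1, 2, 0, 2, 0, 1, 3, 4, 3, 4, 3, 4]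

theorem mem_A1_iff (a : Fin 15) : a ∈ A1 ↔ 3 ≤ edgeClass a := by
  have h : ∀ a : Fin 15, (a = 9 ∨ a = 10 ∨ a = 11 ∨ a = 12 ∨ a = 13 ∨ a = 14) ↔
      3 ≤ edgeClass a := by decide
  simpa [A1] using h a

/-- Distinct colors, both or neither in `{3, 4}`. -/
def PairOK (a b : Fin 5) : Prop := a ≠ b ∧ (3 ≤ a ↔ 3 ≤ b)

/-- Distinct colors, an even number of which are in `{3, 4}`. -/
def TripleOK (a b c : Fin 5) : Prop :=
  a ≠ b ∧ b ≠ c ∧ a ≠ c ∧ (3 ≤ a ↔ (3 ≤ b ↔ ¬ 3 ≤ c))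

instance (a b : Fin 5) : Decidable (PairOK a b) := by
  unfold PairOK
  infer_instance

instance (a b c : Fin 5) : Decidable (TripleOK a b c) := by
  unfold TripleOK
  infer_instance

namespace IsStar

theorem tripleOK : ∀ {a b c : Fin 15}, IsStar a b c →
    TripleOK (edgeClass a) (edgeClass b) (edgeClass c) := by
  decide +kernel

theorem pairOK {a b c : Fin 15} (h : IsStar a b c) (hc : edgeClass c < 3) :
    PairOK (edgeClass a) (edgeClass b) := by
  obtain ⟨hab, -, -, h⟩ := h.tripleOK
  exact ⟨hab, by simpa [hc] using h⟩

theorem edgeClass_lt {a b c : Fin 15} (h : IsStar a b c) (ha : edgeClass a < 3)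
    (hb : edgeClass b < 3) : edgeClass c < 3 := by
  have h' := h.tripleOK.2.2.2
  rw [← not_le] at *
  tauto

theorem edgeClass_lt_of_bridge : ∀ {a b c : Fin 15}, IsStar a b c → c < 3 →
    edgeClass a < 3 ∧ edgeClass b < 3 := by
  decide +kernel

/-- The edge attaching a copy of `S₄` is mapped to a bridge of `S10`. -/
theorem bridge_of_S4 : ∀ {a b c : Fin 15}, IsStar a b c → ∀ {d : Fin 15}, IsStar a b d →
    ∀ {e : Fin 15}, IsStar c d e → e < 3 := by
  decide +kernel

end IsStar

theorem isStar_of_isColoring {f : Fin 36 → Fin 15} (hf : Gstar.IsColoring S10 f) (v : Fin 24)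
    {a b c : Fin 36} (h : Gstar.incFinset v = {a, b, c}) : IsStar (f a) (f b) (f c) := by
  obtain ⟨u, hu⟩ := hf.2 v
  refine isStar_of_eq_incFinset (u := u) (Finset.coe_injective ?_)
  rw [Multigraph.coe_incFinset, ← hu, ← Multigraph.coe_incFinset, h]
  simp [Set.image_insert_eq]

/-- The circuits of even length in the Petersen graph minus a vertex, each given by the list of
its vertices in cyclic order and the set of its edges. -/
def evenCircuits : List (List (Fin 24) × Finset (Fin 36)) :=
  [([0, 1, 2, 3, 8, 5], {0, 1, 2, 6, 10, 3}),
   ([0, 1, 6, 4, 7, 5], {0, 4, 7, 8, 9, 3}),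
   ([1, 2, 7, 5, 8, 6], {1, 5, 9, 10, 11, 4}),
   ([2, 3, 8, 6, 4, 7], {2, 6, 11, 7, 8, 5}),
   ([0, 1, 2, 7, 4, 6, 8, 5], {0, 1, 5, 8, 7, 11, 10, 3}),
   ([0, 1, 6, 8, 3, 2, 7, 5], {0, 4, 11, 6, 2, 5, 9, 3}),
   ([1, 2, 3, 8, 5, 7, 4, 6], {1, 2, 6, 10, 9, 8, 7, 4})]

/-- The edges in `E1` with color in `{3, 4}` are those in `S`. -/
def IsHighSet (x : Fin 12 → Fin 5) (S : Finset (Fin 36)) : Prop :=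
  ∀ i, i.castLE (by decide) ∈ S ↔ 3 ≤ x i

instance (x : Fin 12 → Fin 5) (S : Finset (Fin 36)) : Decidable (IsHighSet x S) := by
  unfold IsHighSet
  infer_instance

theorem exists_isHighSet :
    ∀ a b, PairOK a b → ∀ c d, TripleOK a c d → ∀ e g, TripleOK c e g → ∀ h, PairOK e h →
    ∀ i j, TripleOK b i j → ∀ k, TripleOK h j k → ∀ l, TripleOK d l k →
    ∀ m, PairOK l m → TripleOK g m i →
    ∃ C ∈ evenCircuits, IsHighSet ![a, c, e, b, d, g, h, l, m, i, j, k] C.2 := by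
  decide +kernel

theorem circuit_of_mem_evenCircuits : ∀ C ∈ evenCircuits,
    (∀ e ∈ C.2, e.val ≤ 11) ∧
    (∀ v ∈ C.1, (C.2 ∩ Gstar.incFinset v).card = 2) ∧
    (C.1.IsChain fun x y => ∃ e ∈ C.2, Gstar.ends e = s(x, y)) ∧
    Gstar.support C.2 = C.1.toFinset ∧ (C.1.toFinset.card = 6 ∨ C.1.toFinset.card = 8) := by
  decide +kernel

theorem exists_isHighSet_of_isColoring {f : Fin 36 → Fin 15}
    (hf : Gstar.IsColoring S10 f) :
    ∃ C ∈ evenCircuits, IsHighSet (fun e => edgeClass (f (e.castLE (by decide)))) C.2 := by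
  have star := @isStar_of_isColoring f hf
  have b₁ : f 21 < 3 := (star 15 (a := 24) (b := 25) (c := 26) (by decide +kernel)).bridge_of_S4
    (star 16 (a := 24) (b := 25) (c := 27) (by decide +kernel)) (star 17 (by decide +kernel))
  have b₂ : f 22 < 3 := (star 18 (a := 28) (b := 29) (c := 30) (by decide +kernel)).bridge_of_S4
    (star 19 (a := 28) (b := 29) (c := 31) (by decide +kernel)) (star 20 (by decide +kernel))
  have b₃ : f 23 < 3 := (star 21 (a := 32) (b := 33) (c := 34) (by decide +kernel)).bridge_of_S4
    (star 22 (a := 32) (b := 33) (c := 35) (by decide +kernel)) (star 23 (by decide +kernel))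
  obtain ⟨h₁₂, h₁₈⟩ := (star 10 (a := 12) (b := 18) (by decide +kernel)).edgeClass_lt_of_bridge b₁
  obtain ⟨h₁₃, h₁₉⟩ := (star 11 (a := 13) (b := 19) (by decide +kernel)).edgeClass_lt_of_bridge b₂
  obtain ⟨h₁₆, h₁₇⟩ := (star 14 (a := 16) (b := 17) (by decide +kernel)).edgeClass_lt_of_bridge b₃
  have h₁₄ : edgeClass (f 14) < 3 := (star 9 (by decide +kernel)).edgeClass_lt h₁₂ h₁₃
  have h₁₅ : edgeClass (f 15) < 3 := (star 12 (by decide +kernel)).edgeClass_lt h₁₄ h₁₇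
  have h₂₀ : edgeClass (f 20) < 3 := (star 13 (by decide +kernel)).edgeClass_lt h₁₅ h₁₆
  have key := exists_isHighSet
    _ _ ((star 0 (a := 0) (b := 3) (by decide +kernel)).pairOK h₁₈)
    _ _ (star 1 (a := 0) (b := 1) (c := 4) (by decide +kernel)).tripleOK
    _ _ (star 2 (a := 1) (b := 2) (c := 5) (by decide +kernel)).tripleOK
    _ ((star 3 (a := 2) (b := 6) (by decide +kernel)).pairOK h₁₉)
    _ _ (star 5 (a := 3) (b := 9) (c := 10) (by decide +kernel)).tripleOK
    _ (star 8 (a := 6) (b := 10) (c := 11) (by decide +kernel)).tripleOK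
    _ (star 6 (a := 4) (b := 7) (c := 11) (by decide +kernel)).tripleOK
    _ ((star 4 (a := 7) (b := 8) (by decide +kernel)).pairOK h₂₀)
    (star 7 (a := 5) (b := 8) (c := 9) (by decide +kernel)).tripleOK
  convert key using 4 with C
  ext i
  fin_cases i <;> rfl

/-- If `f` is an `S₁₀`-coloring of `G*`, then the subgraph `H'` of `H` induced by
`f⁻¹(A₁) ∩ E₁` is either a 6-circuit or an 8-circuit: writing `Vs` for the set of
vertices incident with an edge of `F := f⁻¹(A₁) ∩ E₁`, the induced subgraph is
2-regular and connected, and has either 6 or 8 vertices. -/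
theorem preimage_A1_E1_is_6_or_8_circuit (f : Fin 36 → Fin 15)
    (hf : Gstar.IsColoring S10 f) :
    let F := (f ⁻¹' A1) ∩ E1
    let Vs := {v : Fin 24 | ∃ e ∈ F, v ∈ Gstar.ends e}
    (∀ v ∈ Vs, (F ∩ Gstar.inc v).ncard = 2) ∧
    (∀ a ∈ Vs, ∀ b ∈ Vs, Gstar.Reach F a b) ∧
    (Vs.ncard = 6 ∨ Vs.ncard = 8) := by
  intro F Vs
  obtain ⟨C, hC, hFC⟩ := exists_isHighSet_of_isColoring hf
  obtain ⟨hE, h₁, h₂, h₃, h₄⟩ := circuit_of_mem_evenCircuits C hC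
  have hF : F = C.2 := by
    ext e
    simp only [F, Set.mem_inter_iff, Set.mem_preimage, mem_A1_iff, Finset.mem_coe]
    refine ⟨fun ⟨h, h'⟩ => ?_, fun h => ⟨?_, hE e h⟩⟩
    · exact (hFC ⟨e, Nat.lt_succ_of_le h'⟩).mpr h
    · exact (hFC ⟨e, Nat.lt_succ_of_le (hE e h)⟩).mp h
  have hVs : Vs = C.1.toFinset := by
    ext v
    simp [Vs, hF, ← h₃, Multigraph.support]
  rw [hF, hVs, Set.ncard_coe_finset]
  refine ⟨fun v hv => ?_, fun a ha b hb => ?_, h₄⟩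
  · rw [← Multigraph.coe_incFinset, ← Finset.coe_inter, Set.ncard_coe_finset]
    exact h₁ v (by simpa using hv)
  · exact Gstar.reach_of_isChain C.2 h₂ (by simpa using ha) (by simpa using hb)
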